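/- Let R be a Noetherian ring of prime characteristic p > 0 that is F-pure and satisfies Serre's condition (S₂). Assume that either (1) R contains an infinite field, or (2) ht_R M ≥ 2 for every maximal ideal M of R. Then R is strictly closed, and the localization R_𝔭 is an Arf ring for every prime ideal 𝔭 of R with ht_R 𝔭 = 1. -/

import Mathlib

open scoped TensorProduct

universe u v

/-- `R` is strictly closed in the `R`-algebra `S`. -/
def IsStrictlyClosedIn (R S : Type*) [CommRing R] [CommRing S] [Algebra R S] : Prop :=
  ∀ s : S, s ⊗ₜ[R] (1 : S) = (1 : S) ⊗ₜ[R] s → s ∈ (algebraMap R S).range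

/-- `R` is strictly closed (in the integral closure `R̄` of `R` in its total ring of
fractions `Q(R)`). -/
def IsStrictlyClosed (R : Type*) [CommRing R] : Prop :=
  IsStrictlyClosedIn R (integralClosure R (FractionRing R))

/-- A ring homomorphism `f : R →+* S` is pure if for every `R`-module `M` the base-change
map `M → S ⊗_R M`, `m ↦ 1 ⊗ m` (where `S` is regarded as an `R`-module via `f`), is
injective. -/
def RingHom.IsPureHom {R : Type u} {S : Type v} [CommRing R] [CommRing S] (f : R →+* S) : Prop :=
  ∀ (M : Type u) [AddCommGroup M] [Module R M],
    letI : Algebra R S := f.toAlgebra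
    Function.Injective (fun m : M => (1 : S) ⊗ₜ[R] m)

/-- A ring `R` of prime characteristic `p` is `F`-pure if its Frobenius endomorphism
`a ↦ a^p` is a pure ring map. -/
def IsFPure (R : Type*) [CommRing R] (p : ℕ) [Fact p.Prime] [CharP R p] : Prop :=
  (frobenius R p).IsPureHom

/-- A (Noetherian) ring satisfies Serre's condition `(S₂)` iff for every prime `𝔭` the local
ring `R_𝔭` has depth at least `min(2, dim R_𝔭)`, i.e. admits a regular sequence in its
maximal ideal of length at least `min(2, dim R_𝔭)`. -/
def SerreConditionS2 (R : Type*) [CommRing R] : Prop :=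
  ∀ (P : Ideal R) [P.IsPrime],
    ∃ s : List (Localization.AtPrime P),
      (∀ a ∈ s, a ∈ IsLocalRing.maximalIdeal (Localization.AtPrime P)) ∧
      RingTheory.Sequence.IsRegular (Localization.AtPrime P) s ∧
      min 2 (ringKrullDim (Localization.AtPrime P)) ≤ (s.length : WithBot ℕ∞)

/-- `x ∈ A` is integral over the ideal `I`: it satisfies an equation
`xⁿ + c₁xⁿ⁻¹ + ⋯ + cₙ = 0` with `cᵢ ∈ Iⁱ` (and `n ≥ 1`). -/
def IsIntegralOverIdeal {A : Type*} [CommRing A] (I : Ideal A) (x : A) : Prop :=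
  ∃ n : ℕ, 0 < n ∧ ∃ c : ℕ → A, (∀ i, 1 ≤ i → i ≤ n → c i ∈ I ^ i) ∧
    x ^ n + ∑ i ∈ Finset.Icc 1 n, c i * x ^ (n - i) = 0

/-- A (one-dimensional Cohen–Macaulay local) ring `A` is an Arf ring if every integrally
closed ideal `I` of `A` containing a non-zerodivisor is stable, i.e. `I² = aI` for some
`a ∈ I`. -/
def IsArfRing (A : Type*) [CommRing A] : Prop :=
  ∀ I : Ideal A, (∃ x ∈ I, x ∈ nonZeroDivisors A) →
    (∀ x : A, IsIntegralOverIdeal I x → x ∈ I) →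
    ∃ a ∈ I, I ^ 2 = Ideal.span {a} * I

/-- Elementary consequence of `F`-purity: principal ideals are Frobenius closed. -/
def RootClosed (R : Type*) [CommRing R] (p : ℕ) : Prop :=
  ∀ a b : R, b ^ p ∣ a ^ p → b ∣ a

lemma tmul_smul_algebraMap {R S M : Type*} [CommRing R] [CommRing S] [Algebra R S]
    [AddCommGroup M] [Module R M] (x : R) (y : S) (m : M) :
    y ⊗ₜ[R] (x • m) = (algebraMap R S x * y) ⊗ₜ[R] m := by
  rw [← TensorProduct.smul_tmul, Algebra.smul_def]

lemma rootClosed_of_fPure (R : Type*) [CommRing R] (p : ℕ) [Fact p.Prime] [CharP R p]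
    (h : IsFPure R p) : RootClosed R p := by
  intro a b ⟨r, hr⟩
  have key := h (R ⧸ Ideal.span {b})
  have h0 := @key (Ideal.Quotient.mk _ a) 0 (by
    have e1 : (Ideal.Quotient.mk (Ideal.span {b}) a) = a • (1 : R ⧸ Ideal.span {b}) := by
      rw [← map_one (Ideal.Quotient.mk _)]
      change _ = Ideal.Quotient.mk _ (a * 1)
      rw [mul_one]
    have e2 : b • (1 : R ⧸ Ideal.span {b}) = 0 := by
      rw [← map_one (Ideal.Quotient.mk _)]
      change Ideal.Quotient.mk _ (b * 1) = 0
      rw [mul_one, Ideal.Quotient.eq_zero_iff_mem]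
      exact Ideal.mem_span_singleton_self b
    have e3 : ∀ (x y : R) (m : R ⧸ Ideal.span {b}),
        @TensorProduct.tmul R _ R _ _ _ (RingHom.toAlgebra (frobenius R p)).toModule _ y (x • m) =
        @TensorProduct.tmul R _ R _ _ _ (RingHom.toAlgebra (frobenius R p)).toModule _ (x ^ p * y) m := by
      intro x y m
      exact @tmul_smul_algebraMap R R _ _ _ (frobenius R p).toAlgebra _ _ x y m
    change @TensorProduct.tmul R _ R _ _ _ (RingHom.toAlgebra (frobenius R p)).toModule _ 1 _ = 
      @TensorProduct.tmul R _ R _ _ _ (RingHom.toAlgebra (frobenius R p)).toModule _ 1 0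
    rw [e1, e3, hr, mul_assoc, ← e3, e2, @TensorProduct.tmul_zero, @TensorProduct.tmul_zero])
  rw [Ideal.Quotient.eq_zero_iff_mem, Ideal.mem_span_singleton] at h0
  exact h0

lemma rootClosed_localization (R : Type*) [CommRing R] (p : ℕ) (hp : p ≠ 0)
    (h : RootClosed R p) (P : Ideal R) [P.IsPrime] :
    RootClosed (Localization.AtPrime P) p := by
  intro x y hxy
  obtain ⟨a, s, rfl⟩ := IsLocalization.exists_mk'_eq P.primeCompl x
  obtain ⟨b, t, rfl⟩ := IsLocalization.exists_mk'_eq P.primeCompl y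
  have us := IsLocalization.map_units (Localization.AtPrime P) s
  have ut := IsLocalization.map_units (Localization.AtPrime P) t
  have ea := IsLocalization.mk'_spec (Localization.AtPrime P) a s
  have eb := IsLocalization.mk'_spec (Localization.AtPrime P) b t
  set x := IsLocalization.mk' (Localization.AtPrime P) a s
  set y := IsLocalization.mk' (Localization.AtPrime P) b t
  have h1 : (algebraMap R (Localization.AtPrime P) b) ^ p ∣
      (algebraMap R (Localization.AtPrime P) a) ^ p := by
    rw [← ea, ← eb, mul_pow, mul_pow]
    exact ((ut.pow p).mul_right_dvd).2 (hxy.mul_right _)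
  obtain ⟨z, hz⟩ := h1
  obtain ⟨c, u, rfl⟩ := IsLocalization.exists_mk'_eq P.primeCompl z
  have ec := IsLocalization.mk'_spec (Localization.AtPrime P) c u
  have h2 : algebraMap R (Localization.AtPrime P) (u * a ^ p) =
      algebraMap R (Localization.AtPrime P) (b ^ p * c) := by
    rw [map_mul, map_mul, map_pow, map_pow, hz, ← ec]; ring
  obtain ⟨v, hv⟩ := (IsLocalization.eq_iff_exists P.primeCompl _).1 h2
  have h3 : b ∣ (v * u : R) * a := by
    apply h
    obtain ⟨q, rfl⟩ := Nat.exists_eq_succ_of_ne_zero hp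
    refine ⟨c * v * (v * u : R) ^ q, ?_⟩
    calc ((v * u : R) * a) ^ (q + 1) = (v * (u * a ^ (q+1))) * (v * u : R) ^ q := by ring
      _ = _ := by rw [hv]; ring
  have h4 := map_dvd (algebraMap R (Localization.AtPrime P)) h3
  have uv := IsLocalization.map_units (Localization.AtPrime P) v
  have uu := IsLocalization.map_units (Localization.AtPrime P) u
  rw [map_mul, map_mul, ← ea, ← eb, ut.mul_right_dvd, (uv.mul uu).dvd_mul_left, us.dvd_mul_right] at h4
  exact h4

/-- If `γ ⊗ 1 = 1 ⊗ γ`, then `γ` becomes a constant modulo `P` generically. -/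
lemma exists_sub_mem_map (R S : Type*) [CommRing R] [CommRing S] [Algebra R S]
    (P : Ideal R) [P.IsPrime] (γ : S) (hγ : γ ⊗ₜ[R] (1 : S) = (1 : S) ⊗ₜ[R] γ) :
    ∃ s a : R, s ∉ P ∧ s • γ - algebraMap R S a ∈ P.map (algebraMap R S) := by
  classical
  let D := R ⧸ P
  let M := S ⧸ P.map (algebraMap R S)
  let K := FractionRing D
  let L := LocalizedModule (nonZeroDivisors D) M
  let _ : Module K L := inferInstanceAs (Module (Localization (nonZeroDivisors D)) L)
  let f : M →ₗ[D] L := LocalizedModule.mkLinearMap (nonZeroDivisors D) M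
  have : IsScalarTower D K L :=
    inferInstanceAs (IsScalarTower D (Localization (nonZeroDivisors D)) L)
  let g : S → L := fun s => f (Ideal.Quotient.mk _ s)
  have gadd : ∀ x y, g (x + y) = g x + g y := fun x y => by simp [g]
  have gsm : ∀ (r : R) x, g (r • x) = algebraMap D K (Ideal.Quotient.mk P r) • g x := by
    intro r x
    rw [algebraMap_smul, ← map_smul]
    rfl
  have key : ∃ l : K, g γ = l • g 1 := by
    by_contra hcon
    push Not at hcon
    have hg1 : g 1 ≠ 0 := by
      intro h0
      apply hcon 0
      have : g γ = 0 := by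
        have : ∀ m : M, f m = 0 := by
          intro m
          obtain ⟨c, hc⟩ := (IsLocalizedModule.eq_zero_iff (nonZeroDivisors D) f).1 h0
          refine (IsLocalizedModule.eq_zero_iff (nonZeroDivisors D) f).2 ⟨c, ?_⟩
          have : c • m = (c • (1 : M)) * m := by rw [smul_mul_assoc, one_mul]
          rw [this]
          change (c • (Ideal.Quotient.mk _ 1 : M)) * m = 0
          rw [hc, zero_mul]
        exact this _
      rw [this, zero_smul]
    have hnm : g γ ∉ Submodule.span K {g 1} := by
      rw [Submodule.mem_span_singleton]
      rintro ⟨l, hl⟩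
      exact hcon l hl.symm
    obtain ⟨φ, hφ, hφ1⟩ := Submodule.exists_le_ker_of_notMem hnm
    obtain ⟨ψ, hψ, -⟩ := Submodule.exists_le_ker_of_notMem
      (p := (⊥ : Submodule K L)) (v := g 1) (by simpa using hg1)
    have hφ1 : φ (g 1) = 0 := hφ1 (Submodule.mem_span_singleton_self _)
    let B : S →+ S →+ K := AddMonoidHom.mk' (fun x => AddMonoidHom.mk' (fun y => φ (g x) * ψ (g y))
      (fun y z => by rw [gadd, map_add, mul_add]))
      (fun x y => by ext z; simp [gadd, add_mul])
    have hB : ∀ (r : R) (x y : S), B (r • x) y = B x (r • y) := by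
      intro r x y
      simp only [B, AddMonoidHom.mk'_apply, gsm, map_smul, smul_eq_mul]
      ring
    have h1 := congrArg (TensorProduct.liftAddHom B hB) hγ
    rw [TensorProduct.liftAddHom_tmul, TensorProduct.liftAddHom_tmul] at h1
    simp only [B, AddMonoidHom.mk'_apply, hφ1, zero_mul] at h1
    exact (mul_ne_zero hφ hψ) h1
  obtain ⟨l, hl⟩ := key
  obtain ⟨d, ⟨e, he⟩, rfl⟩ := IsLocalization.exists_mk'_eq (nonZeroDivisors D) l
  obtain ⟨a, rfl⟩ := Ideal.Quotient.mk_surjective d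
  obtain ⟨e, rfl⟩ := Ideal.Quotient.mk_surjective e
  have h2 : g (e • γ) = g (a • 1) := by
    rw [gsm, hl, smul_smul, mul_comm, IsLocalization.mk'_spec, gsm]
  have h3 : f (Ideal.Quotient.mk _ (e • γ - a • 1)) = 0 := by
    rw [map_sub, map_sub, sub_eq_zero]
    exact h2
  obtain ⟨⟨c, hc⟩, hc0⟩ := (IsLocalizedModule.eq_zero_iff (nonZeroDivisors D) f).1 h3
  obtain ⟨c, rfl⟩ := Ideal.Quotient.mk_surjective c
  have hc0 : Ideal.Quotient.mk (P.map (algebraMap R S)) (c • (e • γ - a • 1)) = 0 := hc0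
  rw [Ideal.Quotient.eq_zero_iff_mem] at hc0
  refine ⟨c * e, c * a, ?_, ?_⟩
  · intro hce
    have := nonZeroDivisors.ne_zero (mul_mem hc he)
    rw [← map_mul] at this
    exact this (Ideal.Quotient.eq_zero_iff_mem.2 hce)
  · convert hc0 using 1
    rw [smul_sub, smul_smul, smul_smul, Algebra.algebraMap_eq_smul_one]

lemma root_mem_range (R : Type*) [CommRing R] (p : ℕ) (h : RootClosed R p)
    (x : integralClosure R (FractionRing R))
    (hx : x ^ p ∈ (algebraMap R (integralClosure R (FractionRing R))).range) :
    x ∈ (algebraMap R (integralClosure R (FractionRing R))).range := by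
  obtain ⟨r, hr⟩ := hx
  obtain ⟨a, ⟨b, hb⟩, hab⟩ := IsLocalization.exists_mk'_eq (nonZeroDivisors R) (x : FractionRing R)
  have e := IsLocalization.mk'_spec (FractionRing R) a ⟨b, hb⟩
  rw [hab] at e
  have hr' : algebraMap R (FractionRing R) r = (x : FractionRing R) ^ p := congrArg Subtype.val hr
  have inj := IsFractionRing.injective R (FractionRing R)
  obtain ⟨c, hc⟩ := h a b ⟨r, inj (by rw [map_pow, ← e, map_mul, hr', map_pow]; ring)⟩
  refine ⟨c, Subtype.ext ?_⟩
  change algebraMap R (FractionRing R) c = x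
  have ub := IsLocalization.map_units (FractionRing R) (⟨b, hb⟩ : nonZeroDivisors R)
  apply ub.mul_right_cancel
  rw [e, hc, map_mul, mul_comm]

lemma strictlyClosedIn_of_root (R S : Type*) [CommRing R] [IsNoetherianRing R]
    [CommRing S] [Algebra R S] [Algebra.IsIntegral R S]
    (injS : Function.Injective (algebraMap R S))
    (p : ℕ) [Fact p.Prime] [CharP R p]
    (h : ∀ x : S, x ^ p ∈ (algebraMap R S).range → x ∈ (algebraMap R S).range) :
    IsStrictlyClosedIn R S := by
  intro α hα
  by_contra hαn
  let N : Submodule R S := LinearMap.range (Algebra.linearMap R S)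
  -- an associated prime
  obtain ⟨P, hP, t, hPt⟩ : ∃ P : Ideal R, P.IsPrime ∧ ∃ t : R, ∀ r, r ∈ P ↔ r • (t • α) ∈ N := by
    let M := Submodule.span R {N.mkQ α}
    let x : M := ⟨N.mkQ α, Submodule.mem_span_singleton_self _⟩
    have hx : x ≠ 0 := by
      intro h0
      apply hαn
      have : N.mkQ α = 0 := congrArg Subtype.val h0
      rw [Submodule.mkQ_apply, Submodule.Quotient.mk_eq_zero] at this
      exact this
    obtain ⟨P, hP, -⟩ := exists_le_isAssociatedPrime_of_isNoetherianRing R x hx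
    rw [isAssociatedPrime_iff] at hP
    obtain ⟨hP, ⟨m, hm⟩, rfl⟩ := hP
    obtain ⟨t, rfl⟩ := Submodule.mem_span_singleton.1 hm
    refine ⟨_, hP, t, fun r => ?_⟩
    rw [Submodule.mem_colon_singleton, Submodule.mem_bot, ← Subtype.coe_inj]
    change r • t • N.mkQ α = 0 ↔ _
    rw [← map_smul, ← map_smul, Submodule.mkQ_apply, Submodule.Quotient.mk_eq_zero]
  set γ : S := t • α with hγdef
  have hγ : γ ⊗ₜ[R] (1 : S) = (1 : S) ⊗ₜ[R] γ := by
    rw [hγdef, TensorProduct.tmul_smul, ← TensorProduct.smul_tmul', hα]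
  have hPγ : ∀ r ∈ P, ∃ u ∈ P, r • γ = algebraMap R S u := by
    intro r hr
    obtain ⟨u, hu⟩ := (hPt r).1 hr
    have hu : algebraMap R S u = r • γ := hu
    refine ⟨u, ?_, hu.symm⟩
    obtain ⟨f, hf, hfγ⟩ := Algebra.IsIntegral.isIntegral (R := R) γ
    have h1 := Polynomial.scaleRoots_aeval_eq_zero (r := r) (p := f) (a := γ) hfγ
    rw [← Algebra.smul_def, ← hu, Polynomial.aeval_algebraMap_apply, Polynomial.aeval_def] at h1
    have h2 := injS (h1.trans (map_zero _).symm)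
    have hm : (f.scaleRoots r).Monic := (Polynomial.monic_scaleRoots_iff r).2 hf
    rw [Polynomial.eval₂_eq_sum_range, Finset.sum_range_succ, hm.coeff_natDegree, map_one,
      one_mul] at h2
    have h3 : u ^ (f.scaleRoots r).natDegree ∈ P := by
      rw [eq_neg_of_add_eq_zero_right h2]
      refine P.neg_mem (P.sum_mem fun i hi => P.mul_mem_right _ ?_)
      rw [Finset.mem_range, Polynomial.natDegree_scaleRoots] at hi
      rw [Algebra.algebraMap_self_apply, Polynomial.coeff_scaleRoots]
      exact P.mul_mem_left _ (P.pow_mem_of_mem hr _ (by omega))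
    exact hP.mem_of_pow_mem _ h3
  obtain ⟨s, a, hs, hsa⟩ := exists_sub_mem_map R S P γ hγ
  set x : S := s • γ - algebraMap R S a with hx
  have hPx : ∀ i : ℕ, ∀ r ∈ P, ∃ u ∈ P, r • x ^ i = algebraMap R S u := by
    intro i
    induction i with
    | zero => intro r hr; exact ⟨r, hr, by rw [pow_zero, Algebra.algebraMap_eq_smul_one]⟩
    | succ i ih =>
      intro r hr
      obtain ⟨u, hu, e⟩ := ih r hr
      obtain ⟨v, hv, e'⟩ := hPγ u hu
      refine ⟨s * v - u * a, P.sub_mem (P.mul_mem_left _ hv) (P.mul_mem_right _ hu), ?_⟩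
      rw [pow_succ, ← smul_mul_assoc, e, hx, map_sub, map_mul, map_mul, ← e', mul_sub,
        ← Algebra.smul_def, ← Algebra.smul_def, ← Algebra.smul_def, smul_comm]
  obtain ⟨f, hf, hfx, hfc⟩ := Polynomial.exists_monic_aeval_eq_zero_forall_mem_of_mem_map hsa
  have hpow : x ^ p ^ f.natDegree ∈ N := by
    have hle : f.natDegree ≤ p ^ f.natDegree :=
      (Nat.lt_pow_self (Fact.out (p := p.Prime)).one_lt).le
    obtain ⟨k, hk⟩ := Nat.exists_eq_add_of_le hle
    rw [hk, pow_add]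
    rw [Polynomial.aeval_eq_sum_range, Finset.sum_range_succ, hf.coeff_natDegree, one_smul] at hfx
    rw [eq_neg_of_add_eq_zero_right hfx, neg_mul, Finset.sum_mul]
    refine N.neg_mem (N.sum_mem fun i hi => ?_)
    rw [smul_mul_assoc, ← pow_add]
    obtain ⟨u, -, hu⟩ := hPx (i + k) _ (hfc i (Finset.mem_range.1 hi).ne)
    exact ⟨u, hu.symm⟩
  have : CharP S p := charP_of_injective_algebraMap injS p
  rw [hx, sub_pow_char_pow, ← map_pow] at hpow
  have h1 : (s • γ) ^ p ^ f.natDegree ∈ N := by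
    have := N.add_mem hpow (⟨a ^ p ^ f.natDegree, rfl⟩ :
      algebraMap R S (a ^ p ^ f.natDegree) ∈ N)
    rwa [sub_add_cancel] at this
  have h2 : ∀ n : ℕ, ∀ y : S, y ^ p ^ n ∈ N → y ∈ N := by
    intro n
    induction n with
    | zero => intro y hy; simpa using hy
    | succ n ih =>
      intro y hy
      refine ih y (h _ ?_)
      rw [← pow_mul, ← pow_succ]
      exact hy
  exact hs ((hPt s).2 (h2 _ _ h1))

lemma strictlyClosed_of_rootClosed (R : Type*) [CommRing R] [IsNoetherianRing R]
    (p : ℕ) [Fact p.Prime] [CharP R p] (h : RootClosed R p) : IsStrictlyClosed R :=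
  strictlyClosedIn_of_root R _ (fun _ _ hab =>
    IsFractionRing.injective R (FractionRing R) (congrArg Subtype.val hab)) p
    (root_mem_range R p h)

lemma length_quotient_ne_top {A : Type*} [CommRing A] [IsNoetherianRing A]
    (hdim : ringKrullDim A = 1) (I : Ideal A) (b : A) (hb : b ∈ nonZeroDivisors A) (hbI : b ∈ I) :
    Module.length A (A ⧸ I) ≠ ⊤ := by
  have h1 := ringKrullDim_quotient_succ_le_of_nonZeroDivisor hb
  have h2 : ringKrullDim (A ⧸ Ideal.span {b}) ≤ 0 := by
    rw [hdim] at h1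
    have : ringKrullDim (A ⧸ Ideal.span {b}) + 1 ≤ 0 + 1 := by simpa using h1
    revert this
    generalize ringKrullDim (A ⧸ Ideal.span {b}) = d
    intro this
    induction d with
    | bot => exact bot_le
    | coe d =>
      induction d with
      | top => exact absurd this (by decide)
      | coe d =>
        norm_cast at this ⊢
        omega
  have h3 : Ring.KrullDimLE 0 (A ⧸ Ideal.span {b}) := by
    rw [Ring.KrullDimLE, Order.krullDimLE_iff]
    exact_mod_cast h2
  have h4 : IsArtinianRing (A ⧸ Ideal.span {b}) := isArtinianRing_iff_krullDimLE_zero.2 h3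
  have h5 : Module.length A (A ⧸ Ideal.span {b}) ≠ ⊤ := by
    rw [Module.length_eq_of_surjective (R := A ⧸ Ideal.span {b}) (S := A)
      Ideal.Quotient.mk_surjective]
    exact Module.length_ne_top
  have hle : Ideal.span {b} ≤ I := (Ideal.span_singleton_le_iff_mem _).2 hbI
  exact ne_top_of_le_ne_top h5
    (Module.length_le_of_surjective (Submodule.factor hle) (Submodule.factor_surjective hle))

/-- `ℓ(I / aI) = ℓ(A / aA)`. -/
lemma length_ideal_quotient_le {A : Type*} [CommRing A] (I : Ideal A)
    (hI : Module.length A (A ⧸ I) ≠ ⊤) (a : A) (ha : a ∈ nonZeroDivisors A) :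
    Module.length A (I ⧸ Submodule.comap I.subtype (Ideal.span {a} * I)) ≤
      Module.length A (A ⧸ Ideal.span {a}) := by
  have hle : Ideal.span {a} * I ≤ I := Ideal.mul_le_right
  have hle' : Ideal.span {a} * I ≤ Ideal.span {a} := Ideal.mul_le_left
  have e1 : Module.length A (A ⧸ (Ideal.span {a} * I)) =
      Module.length A (I ⧸ Submodule.comap I.subtype (Ideal.span {a} * I)) + Module.length A (A ⧸ I) := by
    refine Module.length_eq_add_of_exact
      (Submodule.mapQ _ (Ideal.span {a} * I) I.subtype le_rfl) (Submodule.factor hle) ?_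
      (Submodule.factor_surjective hle) ?_
    · rw [← LinearMap.ker_eq_bot, Submodule.ker_mapQ, Submodule.mkQ_map_self]
    · intro z
      obtain ⟨z, rfl⟩ := Submodule.mkQ_surjective _ z
      constructor
      · intro hz
        have hz : z ∈ I := (Submodule.Quotient.mk_eq_zero I).1 hz
        exact ⟨Submodule.Quotient.mk ⟨z, hz⟩, rfl⟩
      · rintro ⟨w, hw⟩
        obtain ⟨w, rfl⟩ := Submodule.mkQ_surjective _ w
        rw [← hw]
        exact (Submodule.Quotient.mk_eq_zero I).2 w.2
  have hle2 : I ≤ Submodule.comap (LinearMap.lsmul A A a) (Ideal.span {a} * I) := fun x hx =>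
    Ideal.mul_mem_mul (Ideal.mem_span_singleton_self a) hx
  have e2 : Module.length A (A ⧸ (Ideal.span {a} * I)) =
      Module.length A (A ⧸ I) + Module.length A (A ⧸ Ideal.span {a}) := by
    refine Module.length_eq_add_of_exact
      (Submodule.mapQ I (Ideal.span {a} * I) (LinearMap.lsmul A A a) hle2)
      (Submodule.factor hle') ?_ (Submodule.factor_surjective hle') ?_
    · rw [← LinearMap.ker_eq_bot, Submodule.ker_mapQ, eq_bot_iff, Submodule.map_le_iff_le_comap]
      intro x hx
      have hx : a * x ∈ Ideal.span {a} * I := hx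
      obtain ⟨i, hi, hix⟩ := Ideal.mem_span_singleton_mul.1 hx
      have : i = x := (mul_cancel_left_mem_nonZeroDivisors ha).1 hix
      subst this
      simpa using hi
    · intro z
      obtain ⟨z, rfl⟩ := Submodule.mkQ_surjective _ z
      constructor
      · intro hz
        have hz : z ∈ Ideal.span {a} := (Submodule.Quotient.mk_eq_zero _).1 hz
        obtain ⟨w, rfl⟩ := Ideal.mem_span_singleton.1 hz
        exact ⟨Submodule.Quotient.mk w, rfl⟩
      · rintro ⟨w, hw⟩
        obtain ⟨w, rfl⟩ := Submodule.mkQ_surjective _ w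
        rw [← hw]
        exact (Submodule.Quotient.mk_eq_zero _).2 (Ideal.mem_span_singleton.2 ⟨w, rfl⟩)
  rw [e1, add_comm] at e2
  exact (WithTop.add_left_cancel hI e2).le

lemma exists_relation {A : Type*} [CommRing A] [IsNoetherianRing A] [IsLocalRing A] (I : Ideal A)
    (hI : Module.length A (A ⧸ I) ≠ ⊤) (a : A) (ha : a ∈ nonZeroDivisors A)
    (ham : a ∈ IsLocalRing.maximalIdeal A) (n : ℕ)
    (hn : Module.length A (A ⧸ Ideal.span {a}) ≤ n) (v : Fin (n + 1) → I) :
    ∃ g : Fin (n + 1) → A, (∃ i, g i ∉ IsLocalRing.maximalIdeal A) ∧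
      ∑ i, g i * (v i : A) ∈ IsLocalRing.maximalIdeal A * I := by
  classical
  let m := IsLocalRing.maximalIdeal A
  let k := A ⧸ m
  let _ : Field k := Ideal.Quotient.field m
  let Q := I ⧸ (m • (⊤ : Submodule A I))
  have hle : Submodule.comap I.subtype (Ideal.span {a} * I) ≤ m • (⊤ : Submodule A I) := by
    intro x hx
    obtain ⟨i, hi, hix⟩ := Ideal.mem_span_singleton_mul.1 hx
    have : x = a • (⟨i, hi⟩ : I) := Subtype.ext hix.symm
    rw [this]
    exact Submodule.smul_mem_smul ham trivial
  have h1 : Module.length A Q ≤ n :=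
    ((Module.length_le_of_surjective (Submodule.factor hle) (Submodule.factor_surjective hle)).trans
      (length_ideal_quotient_le I hI a ha)).trans hn
  have h2 : Module.length k Q ≤ n := by
    rw [← Module.length_eq_of_surjective (R := k) (S := A) (M := Q) Ideal.Quotient.mk_surjective]
    exact h1
  have : Module.Finite k Q := Module.Finite.of_restrictScalars_finite A k Q
  have h3 : Module.finrank k Q ≤ n := by
    rw [Module.length_eq_finrank] at h2
    exact_mod_cast h2
  have h4 : ¬ LinearIndependent k (fun i => (Submodule.mkQ _ (v i) : Q)) := by
    intro hli
    have : Fintype.card (Fin (n + 1)) ≤ Module.finrank k Q := hli.fintype_card_le_finrank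
    simp only [Fintype.card_fin] at this
    omega
  obtain ⟨g, hg, i, hi⟩ := Fintype.not_linearIndependent_iff.1 h4
  choose g' hg' using fun i => Ideal.Quotient.mk_surjective (g i)
  refine ⟨g', ⟨i, ?_⟩, ?_⟩
  · intro hm
    apply hi
    rw [← hg' i]
    exact Ideal.Quotient.eq_zero_iff_mem.2 hm
  · have h5 : Submodule.mkQ (m • (⊤ : Submodule A I)) (∑ i, g' i • v i) = 0 := by
      rw [map_sum, ← hg]
      refine Finset.sum_congr rfl fun i _ => ?_
      rw [← hg' i, map_smul]
      rfl
    rw [Submodule.mkQ_apply, Submodule.Quotient.mk_eq_zero, Submodule.mem_smul_top_iff] at h5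
    simpa using h5

lemma pow_pair_le {A : Type*} [CommRing A] (a y : A) (n : ℕ) :
    Ideal.span {a, y} ^ (n + 1) ≤
      Ideal.span {a} * Ideal.span {a, y} ^ n ⊔ Ideal.span {y ^ (n + 1)} := by
  have hs : Ideal.span {a, y} = Ideal.span {a} ⊔ Ideal.span {y} := Ideal.span_insert _ _
  induction n with
  | zero => simp [hs]
  | succ n ih =>
    have hy : Ideal.span {y} ≤ Ideal.span {a, y} := by rw [hs]; exact le_sup_right
    calc Ideal.span {a, y} ^ (n + 1 + 1)
        = Ideal.span {a} * Ideal.span {a, y} ^ (n + 1) ⊔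
          Ideal.span {y} * Ideal.span {a, y} ^ (n + 1) := by
          rw [pow_succ' _ (n + 1)]
          nth_rewrite 1 [hs]
          rw [Ideal.sup_mul]
      _ ≤ Ideal.span {a} * Ideal.span {a, y} ^ (n + 1) ⊔
          Ideal.span {y} * (Ideal.span {a} * Ideal.span {a, y} ^ n ⊔ Ideal.span {y ^ (n + 1)}) :=
          sup_le_sup_left (Ideal.mul_mono_right ih) _
      _ ≤ _ := by
          rw [Ideal.mul_sup, Ideal.span_singleton_mul_span_singleton, ← pow_succ', mul_left_comm,
            ← sup_assoc]
          refine sup_le_sup_right (sup_le le_rfl ?_) _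
          rw [pow_succ' _ n]
          exact Ideal.mul_mono_right (Ideal.mul_mono_left hy)

open Polynomial in
lemma pow_pair_eq_aeval {A Q : Type*} [CommRing A] [CommRing Q] [Algebra A Q] (a y : A) (u : Q)
    (hu : u * algebraMap A Q a = algebraMap A Q y) (n : ℕ) :
    ∀ z ∈ Ideal.span {a, y} ^ n, ∃ f : A[X], f.degree ≤ n ∧
      aeval u f * algebraMap A Q a ^ n = algebraMap A Q z := by
  induction n with
  | zero => intro z _; exact ⟨C z, degree_C_le, by simp⟩
  | succ n ih =>
    intro z hz
    obtain ⟨w, hw, x, hx, rfl⟩ := Submodule.mem_sup.1 (pow_pair_le a y n hz)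
    obtain ⟨w, hw', rfl⟩ := Ideal.mem_span_singleton_mul.1 hw
    obtain ⟨r, rfl⟩ := Ideal.mem_span_singleton.1 hx
    obtain ⟨f, hf, hfw⟩ := ih w hw'
    refine ⟨f + C r * X ^ (n + 1), ?_, ?_⟩
    · refine (degree_add_le _ _).trans (max_le (hf.trans ?_) (degree_C_mul_X_pow_le _ _))
      exact_mod_cast Nat.le_succ n
    · simp only [map_add, map_mul, map_pow, aeval_C, aeval_X]
      rw [← hfw, ← hu]
      ring

open Polynomial in
lemma reduction_step {A : Type*} [CommRing A] [IsNoetherianRing A] [IsLocalRing A]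
    (hdim : ringKrullDim A = 1) [Infinite (IsLocalRing.ResidueField A)]
    (a : A) (ha : a ∈ nonZeroDivisors A) (ham : a ∈ IsLocalRing.maximalIdeal A) (y : A) :
    ∃ c : A, a + c * y ∈ nonZeroDivisors A ∧ ∃ u : FractionRing A, IsIntegral A u ∧
      u * algebraMap A _ (a + c * y) = algebraMap A _ y := by
  classical
  obtain ⟨N, hN⟩ := ENat.ne_top_iff_exists.1
    (length_quotient_ne_top hdim (Ideal.span {a}) a ha (Ideal.mem_span_singleton_self a))
  have hN' : Module.length A (A ⧸ Ideal.span {a}) ≤ (N + 1 : ℕ) := by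
    rw [← hN]; exact_mod_cast Nat.le_succ N
  set n := N + 1 with hn
  set J := Ideal.span {a, y} with hJ
  have haJ : a ∈ J := Ideal.subset_span (by simp)
  have hyJ : y ∈ J := Ideal.subset_span (by simp)
  have hmemJ : ∀ k i, i ≤ k → a ^ i * y ^ (k - i) ∈ J ^ k := by
    intro k i hi
    have := Ideal.mul_mem_mul (Ideal.pow_mem_pow haJ i) (Ideal.pow_mem_pow hyJ (k - i))
    rwa [← pow_add, Nat.add_sub_cancel' hi] at this
  obtain ⟨g, ⟨i0, hi0⟩, hg⟩ := exists_relation (J ^ n)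
    (length_quotient_ne_top hdim _ (a ^ n) (pow_mem ha n) (Ideal.pow_mem_pow haJ n))
    a ha ham n hN' (fun i => ⟨a ^ (i : ℕ) * y ^ (n - i), hmemJ n i (by omega)⟩)
  let res := IsLocalRing.residue A
  let G : (IsLocalRing.ResidueField A)[X] := ∑ i : Fin (n + 1), C (res (g i)) * X ^ (i : ℕ)
  have hG : G ≠ 0 := by
    intro h0
    apply hi0
    have := congrArg (fun q => q.coeff (i0 : ℕ)) h0
    simp only [G, finsetSum_coeff, coeff_C_mul, coeff_X_pow, coeff_zero, Fin.val_inj,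
      mul_ite, mul_one, mul_zero, Finset.sum_ite_eq, Finset.mem_univ, if_true] at this
    exact (IsLocalRing.residue_eq_zero_iff _).1 this
  obtain ⟨d, hd⟩ : ∃ d, G.eval d ≠ 0 := by
    by_contra hcon
    push Not at hcon
    exact hG (Polynomial.funext (by simpa using hcon))
  obtain ⟨c', rfl⟩ := IsLocalRing.residue_surjective d
  obtain ⟨c, rfl⟩ : ∃ c, c' = -c := ⟨-c', by simp⟩
  have hunit : IsUnit (∑ i : Fin (n + 1), g i * (-c) ^ (i : ℕ)) := by
    rw [← IsLocalRing.residue_ne_zero_iff_isUnit]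
    convert hd using 1
    simp [G, eval_finsetSum, res]
  set a' := a + c * y with ha'
  have hJ' : J = Ideal.span {a', y} := by
    apply le_antisymm
    · rw [hJ, Ideal.span_le]
      rintro z (rfl | rfl)
      · exact Ideal.mem_span_pair.2 ⟨1, -c, by rw [ha']; ring⟩
      · exact Ideal.mem_span_pair.2 ⟨0, 1, by ring⟩
    · rw [Ideal.span_le]
      rintro z (rfl | rfl)
      · exact Ideal.mem_span_pair.2 ⟨1, c, by rw [ha']; ring⟩
      · exact hyJ
  have hcong : ∀ i, i ≤ n → a ^ i * y ^ (n - i) - (-c) ^ i * y ^ n ∈ Ideal.span {a'} * J ^ N := by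
    intro i
    induction i with
    | zero => intro _; simp
    | succ i ih =>
      intro hi
      have e : a ^ (i + 1) * y ^ (n - (i + 1)) - (-c) ^ (i + 1) * y ^ n =
          a' * (a ^ i * y ^ (N - i)) + (-c) * (a ^ i * y ^ (n - i) - (-c) ^ i * y ^ n) := by
        have e1 : n - (i + 1) = N - i := by omega
        have e2 : n - i = (N - i) + 1 := by omega
        rw [e1, e2, ha']
        ring
      rw [e]
      exact Ideal.add_mem _ (Ideal.mul_mem_mul (Ideal.mem_span_singleton_self _)
        (hmemJ N i (by omega))) (Ideal.mul_mem_left _ _ (ih (by omega)))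
  have hyn : y ^ n ∈ Ideal.span {a'} * J ^ N ⊔ IsLocalRing.maximalIdeal A * J ^ n := by
    rw [← Ideal.unit_mul_mem_iff_mem _ hunit]
    have e : (∑ i : Fin (n + 1), g i * (-c) ^ (i : ℕ)) * y ^ n =
        -(∑ i : Fin (n + 1), g i * (a ^ (i : ℕ) * y ^ (n - i) - (-c) ^ (i : ℕ) * y ^ n)) +
        ∑ i : Fin (n + 1), g i * (a ^ (i : ℕ) * y ^ (n - i)) := by
      rw [← Finset.sum_neg_distrib, ← Finset.sum_add_distrib, Finset.sum_mul]
      refine Finset.sum_congr rfl fun i _ => by ring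
    rw [e]
    exact Submodule.add_mem_sup (Submodule.neg_mem _ (Submodule.sum_mem _ fun i _ =>
      Ideal.mul_mem_left _ _ (hcong i (by omega)))) hg
  have hle : J ^ n ≤ Ideal.span {a'} * J ^ N := by
    refine Submodule.le_of_le_smul_of_le_jacobson_bot (IsNoetherian.noetherian _)
      (IsLocalRing.maximalIdeal_le_jacobson ⊥) ?_
    have h1 := pow_pair_le a' y N
    rw [← hJ'] at h1
    refine h1.trans (sup_le le_sup_left ?_)
    rw [Ideal.span_singleton_le_iff_mem]
    exact hyn
  have ha'n : a' ∈ nonZeroDivisors A := by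
    obtain ⟨z, -, hz⟩ := Ideal.mem_span_singleton_mul.1 (hle (Ideal.pow_mem_pow haJ n))
    have : a' * z ∈ nonZeroDivisors A := by rw [hz]; exact pow_mem ha n
    exact (mul_mem_nonZeroDivisors.1 this).1
  refine ⟨c, ha'n, IsLocalization.mk' _ y ⟨a', ha'n⟩, ?_, IsLocalization.mk'_spec _ _ _⟩
  have hu := IsLocalization.mk'_spec (FractionRing A) y ⟨a', ha'n⟩
  have hua := IsLocalization.map_units (FractionRing A) (⟨a', ha'n⟩ : nonZeroDivisors A)
  set u := IsLocalization.mk' (FractionRing A) y ⟨a', ha'n⟩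
  obtain ⟨z, hz, hz'⟩ := Ideal.mem_span_singleton_mul.1 (hle (Ideal.pow_mem_pow hyJ n))
  rw [hJ'] at hz
  obtain ⟨f, hf, hfz⟩ := pow_pair_eq_aeval a' y u hu N z hz
  refine ⟨X ^ n - f, monic_X_pow_sub ?_, ?_⟩
  · exact lt_of_le_of_lt hf (by exact_mod_cast Nat.lt_succ_self N)
  · rw [← aeval_def, map_sub, map_pow, aeval_X, sub_eq_zero]
    apply (hua.pow n).mul_right_cancel
    simp only at hu ⊢
    rw [← mul_pow, hu, ← map_pow, ← hz', map_mul, ← hfz, hn]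
    ring

lemma exists_principal_reduction {A : Type*} [CommRing A] [IsNoetherianRing A] [IsLocalRing A]
    (hdim : ringKrullDim A = 1) [Infinite (IsLocalRing.ResidueField A)]
    (I : Ideal A) (hIm : I ≤ IsLocalRing.maximalIdeal A) (b : A) (hbI : b ∈ I)
    (hb : b ∈ nonZeroDivisors A) :
    ∃ a ∈ I, a ∈ nonZeroDivisors A ∧ ∀ y ∈ I, ∃ u : FractionRing A, IsIntegral A u ∧
      u * algebraMap A _ a = algebraMap A _ y := by
  classical
  obtain ⟨s, hs⟩ := (IsNoetherian.noetherian I : I.FG)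
  have key : ∀ s : Finset A, (s : Set A) ⊆ I → ∃ a ∈ I, a ∈ nonZeroDivisors A ∧ ∀ y ∈ s,
      ∃ u : FractionRing A, IsIntegral A u ∧ u * algebraMap A _ a = algebraMap A _ y := by
    intro s
    induction s using Finset.induction_on with
    | empty => intro _; exact ⟨b, hbI, hb, by simp⟩
    | insert y s _ ih =>
      intro hsub
      rw [Finset.coe_insert, Set.insert_subset_iff] at hsub
      obtain ⟨a, haI, ha, has⟩ := ih hsub.2
      obtain ⟨c, hc, u, hu, huy⟩ := reduction_step hdim a ha (hIm haI) y
      refine ⟨a + c * y, I.add_mem haI (I.mul_mem_left _ hsub.1), hc, ?_⟩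
      intro z hz
      rcases Finset.mem_insert.1 hz with rfl | hz
      · exact ⟨u, hu, huy⟩
      · obtain ⟨v, hv, hvz⟩ := has z hz
        refine ⟨v * (1 - algebraMap A _ c * u), hv.mul (isIntegral_one.sub
          (isIntegral_algebraMap.mul hu)), ?_⟩
        rw [← hvz, mul_assoc, sub_mul, mul_assoc, huy, map_add, map_mul]
        ring
  obtain ⟨a, haI, ha, has⟩ := key s (by rw [← hs]; exact Submodule.subset_span)
  refine ⟨a, haI, ha, fun y hy => ?_⟩
  rw [← hs] at hy
  induction hy using Submodule.span_induction with
  | mem x hx => exact has x hx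
  | zero => exact ⟨0, isIntegral_zero, by simp⟩
  | add x y _ _ hx hy =>
    obtain ⟨u, hu, hux⟩ := hx
    obtain ⟨v, hv, hvy⟩ := hy
    exact ⟨u + v, hu.add hv, by rw [add_mul, hux, hvy, map_add]⟩
  | smul r x _ hx =>
    obtain ⟨u, hu, hux⟩ := hx
    exact ⟨algebraMap A _ r * u, isIntegral_algebraMap.mul hu, by
      rw [mul_assoc, hux, smul_eq_mul, map_mul]⟩

lemma arf_of_strictlyClosed {A : Type*} [CommRing A] [IsNoetherianRing A] [IsLocalRing A]
    (hdim : ringKrullDim A = 1) [Infinite (IsLocalRing.ResidueField A)]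
    (hsc : IsStrictlyClosed A) : IsArfRing A := by
  rintro I ⟨b, hbI, hb⟩ hIc
  by_cases htop : I = ⊤
  · exact ⟨1, by rw [htop]; trivial, by rw [htop]; simp [Ideal.span_singleton_one, sq]⟩
  obtain ⟨a, haI, ha, hred⟩ := exists_principal_reduction hdim I
    (IsLocalRing.le_maximalIdeal htop) b hbI hb
  refine ⟨a, haI, le_antisymm ?_ ?_⟩
  swap
  · rw [sq]
    exact Ideal.mul_mono_left ((Ideal.span_singleton_le_iff_mem _).2 haI)
  rw [sq, Ideal.mul_le]
  intro y hy z hz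
  let S := integralClosure A (FractionRing A)
  have injQ := IsFractionRing.injective A (FractionRing A)
  have injS : Function.Injective (algebraMap A S) := fun _ _ hab =>
    injQ (congrArg Subtype.val hab)
  obtain ⟨u, hu, huy⟩ := hred y hy
  obtain ⟨v, hv, hvz⟩ := hred z hz
  let u' : S := ⟨u, hu⟩
  let v' : S := ⟨v, hv⟩
  have eu : a • u' = y • (1 : S) := Subtype.ext (by
    change a • u = y • (1 : FractionRing A)
    rw [Algebra.smul_def, Algebra.smul_def, mul_one, ← huy, mul_comm])
  have ev : a • v' = z • (1 : S) := Subtype.ext (by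
    change a • v = z • (1 : FractionRing A)
    rw [Algebra.smul_def, Algebra.smul_def, mul_one, ← hvz, mul_comm])
  obtain ⟨w, hw⟩ := hsc (z • u') (by
    calc (z • u') ⊗ₜ[A] (1 : S) = u' ⊗ₜ[A] (z • (1 : S)) := TensorProduct.smul_tmul _ _ _
      _ = (a • u') ⊗ₜ[A] v' := by rw [← ev, TensorProduct.smul_tmul]
      _ = (1 : S) ⊗ₜ[A] (y • v') := by rw [eu, TensorProduct.smul_tmul]
      _ = (1 : S) ⊗ₜ[A] (z • u') := by
        congr 1
        apply Subtype.ext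
        change y • v = z • u
        rw [Algebra.smul_def, Algebra.smul_def, ← huy, ← hvz]
        ring)
  have haw : a * w = y * z := by
    apply injS
    rw [map_mul, hw, ← Algebra.smul_def, smul_comm, eu, Algebra.smul_def, Algebra.smul_def,
      mul_one, map_mul, mul_comm]
  have hwI : w ∈ I := by
    apply hIc
    have hmem : algebraMap A S w ∈ I.map (algebraMap A S) := by
      rw [hw, Algebra.smul_def]
      exact Ideal.mul_mem_right _ _ (Ideal.mem_map_of_mem _ hz)
    obtain ⟨f, hf, hfw, hfc⟩ :=
      Polynomial.exists_monic_aeval_eq_zero_forall_mem_pow_of_mem_map hmem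
    rw [Polynomial.aeval_algebraMap_apply] at hfw
    have h2 := injS (hfw.trans (map_zero _).symm)
    rw [Polynomial.aeval_eq_sum_range, Finset.sum_range_succ, hf.coeff_natDegree, one_smul] at h2
    refine ⟨f.natDegree, ?_, fun i => f.coeff (f.natDegree - i), ?_, ?_⟩
    · rw [Nat.pos_iff_ne_zero]
      intro h0
      rw [h0] at h2
      simp at h2
    · intro i _ hi
      have := hfc (f.natDegree - i)
      rwa [Nat.sub_sub_self hi] at this
    · rw [← h2, add_comm]
      congr 1
      refine Finset.sum_bij' (fun i _ => f.natDegree - i) (fun i _ => f.natDegree - i) ?_ ?_ ?_ ?_ ?_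
      · intro i hi; simp only [Finset.mem_Icc, Finset.mem_range] at *; omega
      · intro i hi; simp only [Finset.mem_Icc, Finset.mem_range] at *; omega
      · intro i hi; simp only [Finset.mem_Icc] at *; omega
      · intro i hi; simp only [Finset.mem_range] at *; omega
      · intro i hi; rfl
  rw [← haw]
  exact Ideal.mul_mem_mul (Ideal.mem_span_singleton_self a) hwI

/-- Let `R` be a Noetherian `F`-pure ring of prime characteristic `p`
satisfying Serre's condition `(S₂)`.  If `R` contains an infinite field, or every maximal
ideal of `R` has height at least `2` (heights being expressed as the Krull dimension of the
corresponding localization), then `R` is strictly closed and `R_𝔭` is an Arf ring for every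
prime `𝔭` of height `1`. -/
theorem strictlyClosed_of_fPure_of_S2
    (R : Type*) [CommRing R] [IsNoetherianRing R]
    (p : ℕ) [Fact p.Prime] [CharP R p]
    (hFpure : IsFPure R p) (hS2 : SerreConditionS2 R)
    (hyp : (∃ F : Subring R, IsField F ∧ Infinite F) ∨
      (∀ (M : Ideal R) (_ : M.IsMaximal),
        2 ≤ ringKrullDim (Localization.AtPrime M))) :
    IsStrictlyClosed R ∧
    ∀ (P : Ideal R) (_ : P.IsPrime),
      ringKrullDim (Localization.AtPrime P) = 1 →
      IsArfRing (Localization.AtPrime P) := by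
  have hroot := rootClosed_of_fPure R p hFpure
  refine ⟨strictlyClosed_of_rootClosed R p hroot, ?_⟩
  intro P hP hdim
  have hroot' := rootClosed_localization R p (Fact.out (p := p.Prime)).ne_zero hroot P
  have : CharP (Localization.AtPrime P) p := by
    refine (CharP.charP_iff_prime_eq_zero (Fact.out (p := p.Prime))).2 ?_
    rw [← map_natCast (algebraMap R (Localization.AtPrime P)), CharP.cast_eq_zero, map_zero]
  have : Infinite (IsLocalRing.ResidueField (Localization.AtPrime P)) := by
    rcases hyp with ⟨F, hF, hinf⟩ | hM
    · let _ : Field F := hF.toField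
      exact Infinite.of_injective
        ((IsLocalRing.residue (Localization.AtPrime P)).comp
          ((algebraMap R (Localization.AtPrime P)).comp F.subtype)) (RingHom.injective _)
    · have hPm : ¬ P.IsMaximal := by
        intro hm
        have := hM P hm
        rw [hdim] at this
        exact absurd this (by decide)
      have hinf : Infinite (R ⧸ P) := by
        by_contra hfin
        rw [not_infinite_iff_finite] at hfin
        exact hPm (Ideal.Quotient.maximal_of_isField P (Finite.isField_of_domain (R ⧸ P)))
      have hker : ∀ x ∈ P, ((IsLocalRing.residue (Localization.AtPrime P)).comp
          (algebraMap R (Localization.AtPrime P))) x = 0 := by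
        intro x hx
        rw [RingHom.comp_apply, IsLocalRing.residue_eq_zero_iff]
        exact (IsLocalization.AtPrime.to_map_mem_maximal_iff (Localization.AtPrime P) P x).2 hx
      refine Infinite.of_injective (Ideal.Quotient.lift P _ hker) ?_
      rw [injective_iff_map_eq_zero]
      intro x hx
      obtain ⟨x, rfl⟩ := Ideal.Quotient.mk_surjective x
      rw [Ideal.Quotient.lift_mk, RingHom.comp_apply, IsLocalRing.residue_eq_zero_iff] at hx
      rw [Ideal.Quotient.eq_zero_iff_mem]
      exact (IsLocalization.AtPrime.to_map_mem_maximal_iff (Localization.AtPrime P) P x).1 hx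
  exact arf_of_strictlyClosed hdim (strictlyClosed_of_rootClosed _ p hroot')
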